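/- arXiv:1310.0631 — 5 statements merged into one kernel-verified Lean document; each statement's English description precedes it below -/
import Mathlib

section
/- Let α be a symmetric n×n real matrix, β ∈ ℝⁿ, γ ∈ ℝ, and φ(x) := xᵀαx + 2βᵀx + γ, defining the domain D = {x ∈ ℝⁿ : φ(x) > 0} with boundary ∂D = {φ = 0}. Fix x ∈ D (so φ(x) > 0) and y ∈ ℝⁿ, and define a_{ij}(x) := [ (αx+β)_i (αx+β)_j − α_{ij} φ(x) ] / φ(x)² and b_j(x) := −(αx+β)_j / φ(x). Assume a_{ij}(x) y^i y^j ≥ 0 and t := √(a_{ij}(x) y^i y^j) + b_j(x) y^j > 0. Then φ(x + y/t) = 0, i.e. the point x + y/t lies on ∂D; consequently the Funk metric of D (characterized by the condition that x + y/(k·L_f(x,y)) ∈ ∂D) is the Randers-type metric L_f(x, y) = ( √(a_{ij}(x) y^i y^j) + b_i(x) y^i ) / k, where k > 0 is a constant. -/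
open Matrix

/-- Expansion of the quadratic function `φ(z) = zᵀαz + 2βᵀz + γ` along a line. -/
lemma quadric_add_smul {ι : Type*} [Fintype ι] {α : Matrix ι ι ℝ} (hα : α.IsSymm)
    {β : ι → ℝ} {γ : ℝ} {φ : (ι → ℝ) → ℝ}
    (hφ : ∀ z, φ z = z ⬝ᵥ (α *ᵥ z) + 2 * (β ⬝ᵥ z) + γ) (x y : ι → ℝ) (s : ℝ) :
    φ (x + s • y) = φ x + 2 * s * ((α *ᵥ x + β) ⬝ᵥ y) + s ^ 2 * (y ⬝ᵥ (α *ᵥ y)) := by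
  have hyx : y ⬝ᵥ (α *ᵥ x) = (α *ᵥ x) ⬝ᵥ y := dotProduct_comm _ _
  have hxy : x ⬝ᵥ (α *ᵥ y) = (α *ᵥ x) ⬝ᵥ y := by
    rw [dotProduct_mulVec, ← mulVec_transpose, hα.eq]
  simp only [hφ, mulVec_add, mulVec_smul, add_dotProduct, dotProduct_add, smul_dotProduct,
    dotProduct_smul, smul_eq_mul, hxy, hyx]
  ring

/-- For the quadratic domain `D = {x : φ(x) > 0}` with `φ(x) = xᵀαx + 2βᵀx + γ`,
the point `x + y/t` with `t = √(aᵢⱼ yⁱ yʲ) + bⱼ yʲ` lies on the boundary `{φ = 0}`;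
consequently the Funk metric of `D` (characterized by `x + y/(k Lf(x,y)) ∈ ∂D`) is the
Randers-type metric `Lf(x,y) = (√(aᵢⱼ yⁱ yʲ) + bᵢ yⁱ)/k`. -/
theorem funk_metric_of_quadric (n : ℕ) (α : Matrix (Fin n) (Fin n) ℝ) (hα : α.IsSymm)
    (β : Fin n → ℝ) (γ : ℝ) (φ : (Fin n → ℝ) → ℝ)
    (hφ : ∀ z, φ z = z ⬝ᵥ (α *ᵥ z) + 2 * (β ⬝ᵥ z) + γ)
    (x y : Fin n → ℝ) (hx : 0 < φ x)
    (Q : ℝ)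
    (hQ : Q = (((α *ᵥ x + β) ⬝ᵥ y) ^ 2 - (y ⬝ᵥ (α *ᵥ y)) * φ x) / (φ x) ^ 2)
    (hQ0 : 0 ≤ Q)
    (b : ℝ) (hb : b = -((α *ᵥ x + β) ⬝ᵥ y) / φ x)
    (t : ℝ) (ht : t = Real.sqrt Q + b) (htpos : 0 < t)
    (k Lf : ℝ) (hk : 0 < k) (hLf : Lf = (Real.sqrt Q + b) / k) :
    φ (x + t⁻¹ • y) = 0 ∧ φ (x + (k * Lf)⁻¹ • y) = 0 := by
  have hroot : φ (x + t⁻¹ • y) = 0 := by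
    have hsq := Real.sq_sqrt hQ0
    have hsqrt : √Q = t + ((α *ᵥ x + β) ⬝ᵥ y) / φ x := by rw [ht, hb]; ring
    rw [hsqrt, hQ] at hsq
    rw [quadric_add_smul hα hφ]
    field_simp at hsq ⊢
    have hfactor : φ x * (φ x * t ^ 2 + 2 * t * ((α *ᵥ x + β) ⬝ᵥ y) + y ⬝ᵥ (α *ᵥ y)) = 0 := by
      linear_combination hsq
    linear_combination (mul_eq_zero.mp hfactor).resolve_left hx.ne'
  have hkLf : k * Lf = t := by rw [hLf, ht, mul_div_cancel₀ _ hk.ne']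
  exact ⟨hroot, hkLf ▸ hroot⟩
end

section
/- Fix a constant k > 0 and let D_f be the Funk distance on I = (−1, 1). Then for all a, b, c ∈ I the triangle inequality D_f(a, c) ≤ D_f(a, b) + D_f(b, c) holds, and equality holds if and only if b lies on the segment between a and c (i.e. min(a, c) ≤ b ≤ max(a, c)). -/
/-- The Funk distance of `a, b ∈ I = (-1, 1)` (with constant `k > 0`). -/
noncomputable def funkDist (k a b : ℝ) : ℝ :=
  (1 / (2 * k)) * (|Real.log ((1 - a) * (1 + b) / ((1 - b) * (1 + a)))|
    + Real.log ((1 - a ^ 2) / (1 - b ^ 2)))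

/-- The coordinate on `(-1, 1)` in which the symmetric part of the Funk distance is Euclidean. -/
noncomputable def funkCoord (x : ℝ) : ℝ := Real.log (1 + x) - Real.log (1 - x)

lemma strictMonoOn_funkCoord : StrictMonoOn funkCoord (Set.Ioo (-1 : ℝ) 1) := by
  intro x hx y hy hxy
  have h₁ : Real.log (1 + x) < Real.log (1 + y) :=
    Real.log_lt_log (by linarith [hx.1]) (by linarith)
  have h₂ : Real.log (1 - y) < Real.log (1 - x) :=
    Real.log_lt_log (by linarith [hy.2]) (by linarith)
  unfold funkCoord
  linarith

lemma funkDist_eq_funkCoord (k : ℝ) {a b : ℝ} (ha : a ∈ Set.Ioo (-1 : ℝ) 1)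
    (hb : b ∈ Set.Ioo (-1 : ℝ) 1) :
    funkDist k a b = (1 / (2 * k)) * (|funkCoord b - funkCoord a|
      + (Real.log (1 - a ^ 2) - Real.log (1 - b ^ 2))) := by
  obtain ⟨ha₁, ha₂⟩ := ha
  obtain ⟨hb₁, hb₂⟩ := hb
  have pa : 1 + a ≠ 0 := by linarith
  have ma : 1 - a ≠ 0 := by linarith
  have pb : 1 + b ≠ 0 := by linarith
  have mb : 1 - b ≠ 0 := by linarith
  have sa : 1 - a ^ 2 ≠ 0 := by nlinarith
  have sb : 1 - b ^ 2 ≠ 0 := by nlinarith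
  rw [funkDist, Real.log_div (mul_ne_zero ma pb) (mul_ne_zero mb pa), Real.log_mul ma pb,
    Real.log_mul mb pa, Real.log_div sa sb, funkCoord, funkCoord]
  congr 3
  ring

lemma abs_sub_eq_add_abs_sub_iff (x y z : ℝ) :
    |z - x| = |y - x| + |z - y| ↔ min x z ≤ y ∧ y ≤ max x z := by
  grind

/-- The Funk distance on `(-1, 1)` satisfies the triangle inequality, with equality iff
the middle point lies on the segment between the two extreme points. -/
theorem funkDist_triangle (k : ℝ) (hk : 0 < k) (a b c : ℝ)
    (ha : a ∈ Set.Ioo (-1 : ℝ) 1) (hb : b ∈ Set.Ioo (-1 : ℝ) 1)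
    (hc : c ∈ Set.Ioo (-1 : ℝ) 1) :
    funkDist k a c ≤ funkDist k a b + funkDist k b c ∧
      (funkDist k a c = funkDist k a b + funkDist k b c ↔
        min a c ≤ b ∧ b ≤ max a c) := by
  have hmono := strictMonoOn_funkCoord
  have hpos : 0 < 1 / (2 * k) := by positivity
  rw [funkDist_eq_funkCoord k ha hc, funkDist_eq_funkCoord k ha hb,
    funkDist_eq_funkCoord k hb hc, ← mul_add, mul_le_mul_iff_right₀ hpos,
    mul_right_inj' hpos.ne']
  constructor
  · linarith [abs_sub_le (funkCoord c) (funkCoord b) (funkCoord a)]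
  · have hsegment := abs_sub_eq_add_abs_sub_iff (funkCoord a) (funkCoord b) (funkCoord c)
    rw [min_le_iff, le_max_iff, hmono.le_iff_le ha hb, hmono.le_iff_le hc hb,
      hmono.le_iff_le hb ha, hmono.le_iff_le hb hc] at hsegment
    rw [min_le_iff, le_max_iff, ← hsegment]
    constructor <;> intro h <;> linarith
end

section
/- Let n ≥ 1 and let 𝔉 be the family of projective maps of Euclidean space ℝⁿ, i.e. all maps f : I = (−1, 1) → ℝⁿ of the form f(u) = p + m(u)·v, where p, v ∈ ℝⁿ and m(u) = (α·u + β)/(γ·u + δ) with α, β, γ, δ ∈ ℝ, αδ − βγ ≠ 0, and γ·u + δ ≠ 0 for all u ∈ I (these parametrize the straight lines of ℝⁿ, whose projective parameters are exactly the fractional linear functions since Ric ≡ 0). Then the chain pseudo-distance d induced by 𝔉 vanishes identically: d(x, y) = 0 for all x, y ∈ ℝⁿ. In particular, d(x, y) = 0 does not imply x = y. -/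
open scoped ENNReal

/-- The lengths of chains of maps of `𝔉` joining `x` to `y`:  a chain consists of points
`x = x₀, x₁, …, x_m = y` of `M`, pairs `a₁, b₁, …, a_m, b_m` in `I = (-1,1)` and maps
`f₁, …, f_m ∈ 𝔉` with `fᵢ(aᵢ) = x_{i-1}`, `fᵢ(bᵢ) = xᵢ`; its length is `Σᵢ D_f(aᵢ, bᵢ)`. -/
def chainLengths (k : ℝ) {M : Type*} (𝔉 : Set (ℝ → M)) (x y : M) : Set ℝ≥0∞ :=
  { L | ∃ (m : ℕ) (xs : ℕ → M) (as bs : ℕ → ℝ) (fs : ℕ → ℝ → M),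
      1 ≤ m ∧ xs 0 = x ∧ xs m = y ∧
      (∀ i < m, fs i ∈ 𝔉 ∧ as i ∈ Set.Ioo (-1 : ℝ) 1 ∧ bs i ∈ Set.Ioo (-1 : ℝ) 1 ∧
        fs i (as i) = xs i ∧ fs i (bs i) = xs (i + 1)) ∧
      L = ∑ i ∈ Finset.range m, ENNReal.ofReal (funkDist k (as i) (bs i)) }

/-- The chain pseudo-distance induced by the family `𝔉`: the infimum of the lengths of
all chains from `x` to `y` (the infimum of the empty set being `∞`). -/
noncomputable def chainDist (k : ℝ) {M : Type*} (𝔉 : Set (ℝ → M)) (x y : M) : ℝ≥0∞ :=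
  sInf (chainLengths k 𝔉 x y)

/-- The projective maps of Euclidean space `ℝⁿ`: maps `f : I → ℝⁿ` of the form
`f(u) = p + m(u) • v` where `m` is a fractional linear transformation that is finite
on `I = (-1, 1)`.  (These parametrize the straight lines of `ℝⁿ`, whose projective
parameters are exactly the fractional linear functions since `Ric ≡ 0`.) -/
def euclideanProjMaps (n : ℕ) : Set (ℝ → (Fin n → ℝ)) :=
  { f | ∃ (p v : Fin n → ℝ) (α β γ δ : ℝ), α * δ - β * γ ≠ 0 ∧
      (∀ u ∈ Set.Ioo (-1 : ℝ) 1, γ * u + δ ≠ 0) ∧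
      ∀ u ∈ Set.Ioo (-1 : ℝ) 1, f u = p + ((α * u + β) / (γ * u + δ)) • v }

open Filter Topology

/-- A single link bounds the chain pseudo-distance from above. -/
theorem chainDist_le_of_mem (k : ℝ) {M : Type*} {𝔉 : Set (ℝ → M)} {f : ℝ → M} (hf : f ∈ 𝔉)
    {a b : ℝ} (ha : a ∈ Set.Ioo (-1 : ℝ) 1) (hb : b ∈ Set.Ioo (-1 : ℝ) 1) :
    chainDist k 𝔉 (f a) (f b) ≤ ENNReal.ofReal (funkDist k a b) := by
  refine sInf_le ⟨1, fun i => if i = 0 then f a else f b, fun _ => a, fun _ => b, fun _ => f,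
    le_rfl, by simp, by simp, ?_, by simp⟩
  intro i hi
  obtain rfl : i = 0 := by omega
  exact ⟨hf, ha, hb, by simp, by simp⟩

/-- Affine parametrizations of straight lines are projective maps. -/
theorem affine_mem_euclideanProjMaps {n : ℕ} (p v : Fin n → ℝ) :
    (fun u : ℝ => p + u • v) ∈ euclideanProjMaps n :=
  ⟨p, v, 1, 0, 0, 1, by simp, by simp, by simp⟩

theorem tendsto_funkDist_zero (k : ℝ) : Tendsto (funkDist k 0) (𝓝 0) (𝓝 0) := by
  have h : ContinuousAt (funkDist k 0) 0 := by
    unfold funkDist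
    fun_prop (disch := norm_num)
  simpa [ContinuousAt, funkDist] using h

/-- Any two points of `ℝⁿ` are joined by affine links whose parameters are arbitrarily close. -/
theorem chainDist_euclideanProjMaps (n : ℕ) (k : ℝ) (x y : Fin n → ℝ) :
    chainDist k (euclideanProjMaps n) x y = 0 := by
  have hlim : Tendsto (fun b => ENNReal.ofReal (funkDist k 0 b)) (𝓝[>] 0) (𝓝 0) := by
    simpa using ENNReal.tendsto_ofReal
      ((tendsto_funkDist_zero k).mono_left (nhdsWithin_le_nhds (s := Set.Ioi 0)))
  refine le_antisymm (ge_of_tendsto hlim ?_) zero_le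
  filter_upwards [Ioo_mem_nhdsGT (zero_lt_one' ℝ)] with b hb
  have h := chainDist_le_of_mem k (affine_mem_euclideanProjMaps x (b⁻¹ • (y - x)))
    (a := 0) (b := b) (by simp) ⟨by linarith [hb.1], hb.2⟩
  simpa [smul_smul, mul_inv_cancel₀ hb.1.ne'] using h

/-- The chain pseudo-distance of Euclidean space `ℝⁿ` (induced by the family of
projective maps) vanishes identically; in particular `d(x, y) = 0` does not imply
`x = y`. -/
theorem chainDist_euclidean_eq_zero (n : ℕ) (hn : 1 ≤ n) (k : ℝ) (hk : 0 < k) :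
    (∀ x y : Fin n → ℝ, chainDist k (euclideanProjMaps n) x y = 0) ∧
      ∃ x y : Fin n → ℝ, x ≠ y ∧ chainDist k (euclideanProjMaps n) x y = 0 := by
  refine ⟨chainDist_euclideanProjMaps n k, 0, 1, ?_, chainDist_euclideanProjMaps n k 0 1⟩
  exact fun h => zero_ne_one (congrFun h ⟨0, hn⟩)
end

section
/- (Analytic core of the Finslerian Schwarz lemma.) Let n ≥ 2 be an integer and c, k > 0 constants. Let s : (−1, 1) → ℝ be three times differentiable with s'(u) > 0 for all u, and suppose its Schwarzian derivative satisfies {s, u} ≥ (2c²/(n−1))·(s'(u))² for all u ∈ (−1, 1) (this is equivalent to the inverse function u(s) satisfying {u, s} ≤ −2c²/(n−1), which holds when s is the arc length of a projective map into a Finsler space with Ric_{ij} ≤ −c²·g_{ij}). Define h(u) := k·(1 − u)·s'(u) (respectively h(u) := k·(1 + u)·s'(u)). If h attains a local maximum at a point u₀ ∈ (−1, 1), then h(u₀)² ≤ k²(n−1)/(4c²). -/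
/-- The Schwarzian derivative of a real function `f` at `t`:
`{f, t} = f'''(t)/f'(t) - (3/2) * (f''(t)/f'(t))^2`. -/
noncomputable def schwarzian (f : ℝ → ℝ) (t : ℝ) : ℝ :=
  iteratedDeriv 3 f t / deriv f t - (3 / 2) * (iteratedDeriv 2 f t / deriv f t) ^ 2

/-- Second-order necessary condition for a local maximum. -/
theorem IsLocalMax.deriv_deriv_nonpos {f : ℝ → ℝ} {x : ℝ} (hf : IsLocalMax f x)
    (hc : ContinuousAt f x) : deriv (deriv f) x ≤ 0 := by
  by_contra! hpos
  have hmin : IsLocalMin f x := isLocalMin_of_deriv_deriv_pos hpos hf.deriv_eq_zero hc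
  have hconst : f =ᶠ[nhds x] fun _ => f x := by
    filter_upwards [hf, hmin] with y h₁ h₂ using le_antisymm h₁ h₂
  have hzero : deriv (deriv f) x = 0 := by
    rw [hconst.deriv.deriv_eq]
    simp
  exact hpos.ne' hzero

/-- Analytic core of the Finslerian Schwarz lemma: if `s : (-1,1) → ℝ` is three times
differentiable with `s' > 0` and `{s, u} ≥ (2c²/(n-1))(s'(u))²` (equivalently, its
inverse satisfies `{u, s} ≤ -2c²/(n-1)`), and if `h(u) = k(1 + εu) s'(u)` (with
`ε = ±1`, i.e. `h = k(1 ∓ u)s'`, the ratio `ds_M/ds_I` of the Finslerian arc length to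
the Funk length element) attains a local maximum at `u₀ ∈ (-1,1)`, then
`h(u₀)² ≤ k²(n-1)/(4c²)`. -/
theorem schwarz_lemma_core (n : ℕ) (hn : 2 ≤ n) (c k : ℝ) (hc : 0 < c) (hk : 0 < k)
    (s : ℝ → ℝ)
    (hs3 : ∀ u ∈ Set.Ioo (-1 : ℝ) 1, ContDiffAt ℝ 3 s u)
    (hs' : ∀ u ∈ Set.Ioo (-1 : ℝ) 1, 0 < deriv s u)
    (hSch : ∀ u ∈ Set.Ioo (-1 : ℝ) 1,
      (2 * c ^ 2 / ((n : ℝ) - 1)) * (deriv s u) ^ 2 ≤ schwarzian s u)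
    (ε : ℝ) (hε : ε = 1 ∨ ε = -1)
    (h : ℝ → ℝ) (hh : ∀ u, h u = k * (1 + ε * u) * deriv s u)
    (u₀ : ℝ) (hu₀ : u₀ ∈ Set.Ioo (-1 : ℝ) 1) (hmax : IsLocalMax h u₀) :
    (h u₀) ^ 2 ≤ k ^ 2 * ((n : ℝ) - 1) / (4 * c ^ 2) := by
  have hi₂ : iteratedDeriv 2 s = deriv (deriv s) := by
    rw [iteratedDeriv_succ, iteratedDeriv_one]
  have hi₃ : iteratedDeriv 3 s = deriv (deriv (deriv s)) := by
    rw [iteratedDeriv_succ, hi₂]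
  have hsmooth : ∀ u ∈ Set.Ioo (-1 : ℝ) 1, ContDiffAt ℝ 2 (deriv s) u := by
    intro u hu
    exact (hs3 u hu).derivWithin two_add_one_eq_three.le
  have hd₁ : ∀ u ∈ Set.Ioo (-1 : ℝ) 1, HasDerivAt (deriv s) (deriv (deriv s) u) u := by
    intro u hu
    exact ((hsmooth u hu).differentiableAt two_ne_zero).hasDerivAt
  have hd₂ : HasDerivAt (deriv (deriv s)) (deriv (deriv (deriv s)) u₀) u₀ := by
    have hd : ContDiffAt ℝ 1 (deriv (deriv s)) u₀ :=
      (hsmooth u₀ hu₀).derivWithin one_add_one_eq_two.le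
    exact (hd.differentiableAt one_ne_zero).hasDerivAt
  have haff : ∀ u : ℝ, HasDerivAt (fun x => k * (1 + ε * x)) (k * ε) u := by
    intro u
    simpa using (((hasDerivAt_id u).const_mul ε).const_add 1).const_mul k
  have hh₁ : ∀ u ∈ Set.Ioo (-1 : ℝ) 1,
      HasDerivAt h (k * ε * deriv s u + k * (1 + ε * u) * deriv (deriv s) u) u := by
    intro u hu
    rw [funext hh]
    exact (haff u).mul (hd₁ u hu)
  have hderiv : deriv h =ᶠ[nhds u₀]
      fun u => k * ε * deriv s u + k * (1 + ε * u) * deriv (deriv s) u := by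
    filter_upwards [Ioo_mem_nhds hu₀.1 hu₀.2] with u hu using (hh₁ u hu).deriv
  have hh₂ := hderiv.deriv_eq.trans
    (((hd₁ u₀ hu₀).const_mul (k * ε)).add ((haff u₀).mul hd₂)).deriv
  have hnonpos := hmax.deriv_deriv_nonpos (hh₁ u₀ hu₀).continuousAt
  have hcrit := hmax.deriv_eq_zero
  rw [hh₂] at hnonpos
  rw [(hh₁ u₀ hu₀).deriv] at hcrit
  have hS := hSch u₀ hu₀
  have hp := hs' u₀ hu₀
  rw [schwarzian, hi₂, hi₃] at hS
  rw [hh]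
  generalize deriv (deriv (deriv s)) u₀ = r at *
  generalize deriv (deriv s) u₀ = q at *
  generalize deriv s u₀ = p at *
  have hε₂ : ε ^ 2 = 1 := by rcases hε with rfl | rfl <;> norm_num
  have ha : 0 < 1 + ε * u₀ := by
    obtain ⟨h₁, h₂⟩ := hu₀
    rcases hε with rfl | rfl <;> linarith
  generalize 1 + ε * u₀ = a at *
  have hn₁ : (0 : ℝ) < n - 1 := by
    have : (2 : ℝ) ≤ n := by exact_mod_cast hn
    linarith
  have hq : q / p = -ε / a := by
    rw [div_eq_div_iff hp.ne' ha.ne']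
    apply mul_left_cancel₀ hk.ne'
    linarith
  have hr : r / p ≤ 2 / a ^ 2 := by
    rw [div_le_div_iff₀ hp (by positivity)]
    have hq' : a * q = -ε * p := by
      rw [div_eq_div_iff hp.ne' ha.ne'] at hq
      linarith
    have hle : 2 * ε * q + a * r ≤ 0 := by
      refine le_of_mul_le_mul_left ?_ hk
      linarith
    have hmul := mul_le_mul_of_nonneg_left hle ha.le
    linear_combination hmul - 2 * ε * hq' + 2 * p * hε₂
  have hbound : 2 * c ^ 2 / ((n : ℝ) - 1) * p ^ 2 ≤ 1 / (2 * a ^ 2) := by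
    rw [hq, div_pow, neg_sq, hε₂] at hS
    have hsum : 2 / a ^ 2 - 3 / 2 * (1 / a ^ 2) = 1 / (2 * a ^ 2) := by
      field_simp
      norm_num
    linarith
  rw [div_mul_eq_mul_div, div_le_div_iff₀ hn₁ (by positivity)] at hbound
  rw [le_div_iff₀ (by positivity)]
  have hmul := mul_le_mul_of_nonneg_left hbound (sq_nonneg k)
  linear_combination hmul
end

section
/- Let D ⊂ ℝⁿ be a bounded open convex set and k > 0 a constant. For A, B ∈ D with A ≠ B, let P(A, B) denote the unique point of the frontier of D of the form A + s·(B − A) with s > 1 (so that B lies strictly between A and P(A, B)), and define the Funk distance f(A, B) := (1/k)·ln( ‖A − P(A, B)‖ / ‖B − P(A, B)‖ ), with f(A, A) := 0. Then for all A, B, C ∈ D the triangle inequality holds: f(A, C) ≤ f(A, B) + f(B, C). -/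
/-- If `P = A + s • (B - A)` with `s > 1`, then `AP / BP = s / (s - 1)`. -/
lemma norm_sub_div_norm_sub_lineMap {E : Type*} [NormedAddCommGroup E] [NormedSpace ℝ E]
    {A B : E} (hAB : A ≠ B) {s : ℝ} (hs : 1 < s) :
    ‖A - (A + s • (B - A))‖ / ‖B - (A + s • (B - A))‖ = s / (s - 1) := by
  have hA : A - (A + s • (B - A)) = (-s) • (B - A) := by module
  have hB : B - (A + s • (B - A)) = (-(s - 1)) • (B - A) := by module
  have hne : ‖B - A‖ ≠ 0 := norm_ne_zero_iff.mpr (sub_ne_zero.mpr hAB.symm)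
  rw [hA, hB, norm_smul, norm_smul, mul_div_mul_right _ _ hne, norm_neg, norm_neg,
    Real.norm_of_nonneg (by linarith), Real.norm_of_nonneg (by linarith)]

/-- A linear functional bounded by `c` at `P = A + s • (B - A)`, `s > 1`, and below `c` at `B`
bounds the ratio `AP / BP` from below. -/
lemma sub_div_sub_le_of_apply_le {E : Type*} [NormedAddCommGroup E] [NormedSpace ℝ E]
    (g : E →L[ℝ] ℝ) {c : ℝ} {A B : E} (hB : g B < c) {s : ℝ} (hs : 1 < s)
    (hP : g (A + s • (B - A)) ≤ c) : (c - g A) / (c - g B) ≤ s / (s - 1) := by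
  rw [div_le_div_iff₀ (by linarith) (by linarith)]
  simp only [map_add, map_smul, map_sub, smul_eq_mul] at hP
  linarith

/-- If a linear functional takes the value `c` at `P = A + s • (B - A)`, `s > 1`, and is below `c`
at `B`, then it computes the ratio `AP / BP`. -/
lemma sub_div_sub_eq_of_apply_eq {E : Type*} [NormedAddCommGroup E] [NormedSpace ℝ E]
    (g : E →L[ℝ] ℝ) {c : ℝ} {A B : E} (hB : g B < c) {s : ℝ} (hs : 1 < s)
    (hP : g (A + s • (B - A)) = c) : (c - g A) / (c - g B) = s / (s - 1) := by
  rw [div_eq_div_iff (by linarith) (by linarith)]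
  simp only [map_add, map_smul, map_sub, smul_eq_mul] at hP
  linarith

/-- The Funk distance on a bounded open convex domain `D ⊂ ℝⁿ` satisfies the triangle
inequality.  Here `P A B` is the point where the ray from `A` through `B` meets the
boundary of `D` (in the order `A`, `B`, `P A B`), and
`f A B = (1/k) log(‖A - P A B‖ / ‖B - P A B‖)` for `A ≠ B`, `f A A = 0`. -/
theorem funk_distance_triangle (n : ℕ) (D : Set (EuclideanSpace ℝ (Fin n)))
    (hDconv : Convex ℝ D) (hDopen : IsOpen D) (hDbdd : Bornology.IsBounded D)
    (k : ℝ) (hk : 0 < k)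
    (P : EuclideanSpace ℝ (Fin n) → EuclideanSpace ℝ (Fin n) → EuclideanSpace ℝ (Fin n))
    (hP : ∀ A ∈ D, ∀ B ∈ D, A ≠ B →
      P A B ∈ frontier D ∧ ∃ s : ℝ, 1 < s ∧ P A B = A + s • (B - A))
    (f : EuclideanSpace ℝ (Fin n) → EuclideanSpace ℝ (Fin n) → ℝ)
    (hf : ∀ A ∈ D, ∀ B ∈ D, A ≠ B →
      f A B = (1 / k) * Real.log (‖A - P A B‖ / ‖B - P A B‖))
    (hf0 : ∀ A ∈ D, f A A = 0) :
    ∀ A ∈ D, ∀ B ∈ D, ∀ C ∈ D, f A C ≤ f A B + f B C := by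
  have lower_bound : ∀ (g : EuclideanSpace ℝ (Fin n) →L[ℝ] ℝ) (c : ℝ), (∀ x ∈ D, g x < c) →
      ∀ A ∈ D, ∀ B ∈ D, (1 / k) * Real.log ((c - g A) / (c - g B)) ≤ f A B := by
    intro g c hg A hA B hB
    have hAc := hg A hA
    have hBc := hg B hB
    rcases eq_or_ne A B with rfl | hAB
    · rw [hf0 A hA, div_self (by linarith), Real.log_one, mul_zero]
    · obtain ⟨hPD, s, hs, hPs⟩ := hP A hA B hB hAB
      have hPc : g (P A B) ≤ c :=
        closure_minimal (fun x hx => (hg x hx).le)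
          (isClosed_le g.continuous continuous_const) (frontier_subset_closure hPD)
      rw [hf A hA B hB hAB, hPs, norm_sub_div_norm_sub_lineMap hAB hs]
      have hpos : 0 < (c - g A) / (c - g B) := div_pos (by linarith) (by linarith)
      have hle := sub_div_sub_le_of_apply_le g hBc hs (hPs ▸ hPc)
      gcongr
  intro A hA B hB C hC
  rcases eq_or_ne A C with rfl | hAC
  · have hAB := lower_bound 0 1 (by simp) A hA B hB
    have hBA := lower_bound 0 1 (by simp) B hB A hA
    simp only [zero_apply, sub_zero, div_one, Real.log_one, mul_zero] at hAB hBA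
    rw [hf0 A hA]
    exact add_nonneg hAB hBA
  · obtain ⟨hQD, s, hs, hQs⟩ := hP A hA C hC hAC
    obtain ⟨g, hg⟩ := geometric_hahn_banach_open_point hDconv hDopen
      (fun hQ => (hDopen.frontier_eq ▸ hQD).2 hQ)
    have hAB := lower_bound g _ hg A hA B hB
    have hBC := lower_bound g _ hg B hB C hC
    have hA' := sub_pos.mpr (hg A hA)
    have hB' := sub_pos.mpr (hg B hB)
    have hC' := sub_pos.mpr (hg C hC)
    have hfAC : f A C = (1 / k) * Real.log ((g (P A C) - g A) / (g (P A C) - g C)) := by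
      rw [sub_div_sub_eq_of_apply_eq g (hg C hC) hs (congrArg g hQs.symm), hf A hA C hC hAC, hQs,
        norm_sub_div_norm_sub_lineMap hAC hs]
    rw [Real.log_div hA'.ne' hB'.ne'] at hAB
    rw [Real.log_div hB'.ne' hC'.ne'] at hBC
    rw [hfAC, Real.log_div hA'.ne' hC'.ne']
    linarith
end
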